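/- Let u ∈ L²(𝕋^d), h > 0, ω a resonant direction, b ∈ C_c(I_ω), and let K_b be the operator on L²(γ_ω) with matrix coefficients k_b(m,n) = Σ_{r∈ω_c^⊥} b(hr) û((m/|p_ω|)ν_ω+r) conj(û((n/|p_ω|)ν_ω+r)) for m ≡ n ≡ c (mod |p_ω|²) and 0 otherwise. Then for every v = Σ_{m∈ℤ} v_m φ_m^ω ∈ L²(γ_ω), (K_b v | v)_{L²(γ_ω)} = Σ_{[c]∈ℤ/|p_ω|²ℤ} Σ_{r∈ω_c^⊥} b(hr) |Σ_{n∈[c]} v_n û((n/|p_ω|)ν_ω+r)|². In particular, (K_b v | v) ≥ 0 whenever b ≥ 0. -/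

import Mathlib

/-!
Setting (F. Macià, "High-frequency propagation for the Schrödinger equation on
the torus").

The flat torus `𝕋^d = ℝ^d/(2πℤ)^d` is modelled as `Fin d → AddCircle (2π)`; an
element `u ∈ L²(𝕋^d)` is represented by its sequence of Fourier coefficients
`û : ℤ^d → ℂ` (with respect to the orthonormal basis `ψ_k = (2π)^{-d/2} e^{ik·x}`),
and operators on `L²(γ_ω)` by their kernels (matrices) in the orthonormal basis
`φ_m^ω(s) = e^{ims/|p_ω|}/√(2π|p_ω|)`, `m ∈ ℤ`.
-/

noncomputable section

open MeasureTheory Filter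
open scoped BigOperators ComplexConjugate Topology ENNReal

namespace TorusSchrodinger

instance fact_two_pi_pos : Fact (0 < 2 * Real.pi) := ⟨by positivity⟩

/-- The lattice `ℤ^d` of Fourier frequencies. -/
abbrev Zd (d : ℕ) := Fin d → ℤ
/-- Euclidean space `ℝ^d` (the fibre of `T^*𝕋^d`). -/
abbrev Rd (d : ℕ) := Fin d → ℝ
/-- The standard flat torus `𝕋^d = ℝ^d/(2πℤ)^d`. -/
abbrev Td (d : ℕ) := Fin d → AddCircle (2 * Real.pi)
/-- The phase space `T^*𝕋^d ≅ 𝕋^d × ℝ^d`. -/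
abbrev Phase (d : ℕ) := Td d × Rd d

variable {d : ℕ}

/-- Inclusion of the lattice `ℤ^d` into `ℝ^d`. -/
def toRd (k : Zd d) : Rd d := fun i => (k i : ℝ)

/-- The canonical projection `ℝ^d → 𝕋^d`. -/
def torusProj (x : Rd d) : Td d := fun i => (x i : AddCircle (2 * Real.pi))

/-- The character `e^{i k·x}` on the torus `𝕋^d`. -/
def char (k : Zd d) (x : Td d) : ℂ := ∏ i, fourier (k i) (x i)

/-- Euclidean inner product of two lattice vectors. -/
def dotZ (k l : Zd d) : ℤ := ∑ i, k i * l i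

/-- Euclidean inner product of a lattice vector with a vector of `ℝ^d`. -/
def dotR (k : Zd d) (ξ : Rd d) : ℝ := ∑ i, (k i : ℝ) * ξ i

/-- The set `Ω` of resonant frequencies in `ℝ^d`. -/
def Omega (d : ℕ) : Set (Rd d) := {ξ | ∃ k : Zd d, k ≠ 0 ∧ dotR k ξ = 0}

/-- A resonant direction `ω ∈ 𝕎`, encoded by its primitive lattice vector `p_ω`:
the nonzero components of `p_ω` are coprime and its first nonzero component is
positive. -/
structure ResonantDir (d : ℕ) where
  p : Zd d
  ne : p ≠ 0
  gcd_one : Finset.univ.gcd (fun i => (p i).natAbs) = 1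
  first_pos : ∀ i, (∀ j, j < i → p j = 0) → 0 ≤ p i

/-- `|p_ω|²`, as an integer. -/
def ResonantDir.M (ω : ResonantDir d) : ℤ := dotZ ω.p ω.p

/-- Orthogonal projection of a lattice point onto the hyperplane `I_ω`. -/
def projPerp (ω : ResonantDir d) (k : Zd d) : Rd d :=
  toRd k - (((dotZ k ω.p : ℝ) / (ω.M : ℝ)) • toRd ω.p)

/-- The set `ω_n^⊥ ⊆ I_ω`: those `r` in the hyperplane `I_ω` with
`(n/|p_ω|)ν_ω + r ∈ ℤ^d` (note `(n/|p_ω|)ν_ω = (n/|p_ω|²) p_ω`). -/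
def perpSet (ω : ResonantDir d) (n : ℤ) : Set (Rd d) :=
  {r | dotR ω.p r = 0 ∧ ∃ k : Zd d, toRd k = ((n : ℝ) / (ω.M : ℝ)) • toRd ω.p + r}

/-! Kernels: operators on `L²(γ_ω)` are represented by their matrix in the
orthonormal basis `(φ_m^ω)_{m ∈ ℤ}`. -/

/-- Kernels of Hermitian operators. -/
def KerHermitian (K : ℤ → ℤ → ℂ) : Prop := ∀ m n, K n m = conj (K m n)

/-- Positive (semidefinite) kernels: the quadratic form is nonnegative on all
finitely supported vectors. -/
def KerPos (K : ℤ → ℤ → ℂ) : Prop :=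
  ∀ v : ℤ →₀ ℂ, 0 ≤ (∑ m ∈ v.support, ∑ n ∈ v.support, conj (v m) * K m n * v n).re

/-- Hilbert–Schmidt kernels. -/
def IsHSKer (K : ℤ → ℤ → ℂ) : Prop := Summable fun q : ℤ × ℤ => ‖K q.1 q.2‖ ^ 2

/-- Trace class kernels: products of two Hilbert–Schmidt kernels. -/
def IsTraceClassKer (K : ℤ → ℤ → ℂ) : Prop :=
  ∃ A B : ℤ → ℤ → ℂ, IsHSKer A ∧ IsHSKer B ∧ ∀ m n, K m n = ∑' j : ℤ, A m j * B j n

/-- Kernels of operators of operator norm at most 1. -/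
def KerContraction (C : ℤ → ℤ → ℂ) : Prop :=
  ∀ v : ℤ →₀ ℂ, ∑' m : ℤ, ‖∑ n ∈ v.support, C m n * v n‖ ^ 2 ≤ ∑ n ∈ v.support, ‖v n‖ ^ 2

/-- The trace norm `tr|K|` of a kernel, via duality with contractions. -/
def traceNorm (K : ℤ → ℤ → ℂ) : ℝ :=
  ⨆ C : {C : ℤ → ℤ → ℂ // KerContraction C}, ‖∑' q : ℤ × ℤ, K q.1 q.2 * C.1 q.2 q.1‖

/-- Truncation of a kernel to the square `[-N,N]²`. -/
def kerTrunc (N : ℕ) (C : ℤ → ℤ → ℂ) : ℤ → ℤ → ℂ := fun m n =>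
  if m.natAbs ≤ N ∧ n.natAbs ≤ N then C m n else 0

/-- The operator norm of a kernel. -/
def kerOpNorm (C : ℤ → ℤ → ℂ) : ℝ :=
  ⨆ v : {v : ℤ →₀ ℂ // ∑ n ∈ v.support, ‖v n‖ ^ 2 ≤ 1},
    Real.sqrt (∑' m : ℤ, ‖∑ n ∈ v.1.support, C m n * v.1 n‖ ^ 2)

/-- Kernels of compact operators: operator-norm limits of their finite truncations. -/
def KerCompact (C : ℤ → ℤ → ℂ) : Prop :=
  Tendsto (fun N : ℕ => kerOpNorm fun m n => C m n - kerTrunc N C m n) atTop (𝓝 0)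

/-! Wigner distributions. -/

/-- Fourier coefficients of the solution at time `t` of the Schrödinger equation
`i∂_t u + (1/2)Δu = 0` on `𝕋^d` in terms of those of the initial datum. -/
def schrodinger (t : ℝ) (u : Zd d → ℂ) : Zd d → ℂ := fun k =>
  Complex.exp (-Complex.I * (t : ℂ) * (((∑ i, ((k i : ℝ)) ^ 2 : ℝ)) : ℂ) / 2) * u k

/-- The pairing `⟨w_u^h, a⟩` of the Wigner distribution at scale `h` of (the
function with Fourier coefficients) `u` with a symbol `a` on `T^*𝕋^d`. -/
def wignerPair (u : Zd d → ℂ) (h : ℝ) (a : Phase d → ℂ) : ℂ :=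
  (((2 * Real.pi) ^ d : ℝ) : ℂ)⁻¹ *
    ∑' q : Zd d × Zd d,
      u q.1 * conj (u q.2) *
        ∫ x : Td d, a (x, (h / 2) • (toRd q.1 + toRd q.2)) * char (q.1 - q.2) x

/-- Test symbols `a ∈ C_c^∞(T^*𝕋^d)`. -/
def IsSymbol (a : Phase d → ℂ) : Prop :=
  Continuous a ∧ HasCompactSupport a ∧
    ContDiff ℝ (⊤ : ℕ∞) fun q : Rd d × Rd d => a (torusProj q.1, q.2)

/-- A sequence of data `(u_h)` in `L²(𝕋^d)` (given by their Fourier coefficients),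
bounded in `L²`, with scales `h → 0⁺`. -/
structure WignerData (d : ℕ) where
  h : ℕ → ℝ
  u : ℕ → Zd d → ℂ
  h_pos : ∀ n, 0 < h n
  h_lim : Tendsto h atTop (𝓝 0)
  bounded : ∃ C : ℝ, ∀ n, ∑' k, ‖u n k‖ ^ 2 ≤ C

/-- Extraction of a subsequence. -/
def WignerData.sub (D : WignerData d) (σ : ℕ → ℕ) (hσ : StrictMono σ) : WignerData d where
  h := D.h ∘ σ
  u := D.u ∘ σ
  h_pos n := D.h_pos (σ n)
  h_lim := D.h_lim.comp hσ.tendsto_atTop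
  bounded := D.bounded.imp fun _C hC n => hC (σ n)

/-- The `h`-oscillation property:
`limsup_{h→0⁺} ∑_{|k| > R/h} |û_h(k)|² → 0` as `R → ∞`. -/
def HOsc (D : WignerData d) : Prop :=
  Tendsto (fun R : ℝ =>
      limsup (fun n =>
        ∑' k : {k : Zd d // R ^ 2 < (∑ i, ((k i : ℝ)) ^ 2) * (D.h n) ^ 2}, ‖D.u n k.1‖ ^ 2)
        atTop)
    atTop (𝓝 0)

/-- `μ0` is the semiclassical (Wigner) measure of the sequence `(u_h)`:
`w_{u_h}^h(0,·) ⇀ μ0`. -/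
def IsSemiclassical (D : WignerData d) (μ0 : Measure (Phase d)) : Prop :=
  ∀ a : Phase d → ℂ, IsSymbol a →
    Tendsto (fun n => wignerPair (D.u n) (D.h n) a) atTop (𝓝 (∫ q, a q ∂μ0))

/-- `μ` is a time-averaged Wigner limit of the Schrödinger evolution of `(u_h)`. -/
def IsTimeAvgLimit (D : WignerData d) (μ : ℝ → Measure (Phase d)) : Prop :=
  ∀ a : Phase d → ℂ, IsSymbol a → ∀ φ : ℝ → ℂ, Integrable φ →
    Tendsto (fun n => ∫ t : ℝ, φ t * wignerPair (schrodinger t (D.u n)) (D.h n) a) atTop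
      (𝓝 (∫ t : ℝ, φ t * ∫ q, a q ∂(μ t)))

/-! The resonant Wigner distribution and resonant Wigner measures. -/

/-- The pairing `tr ∫ b(ξ) R_u^h(ω, dξ)` of the resonant Wigner distribution of `u`
at scale `h` in the resonant direction `ω` with an operator-valued test function
`b` (given by its kernel in the basis `(φ_m^ω)`).  The parametrisation
`k = (m/|p_ω|)ν_ω + r`, `j = (n/|p_ω|)ν_ω + r` (so `m = k·p_ω`, `n = j·p_ω`,
`r = projPerp ω k`) of pairs of frequencies with `k - j ∈ ℤ p_ω` is used. -/
def resPair (u : Zd d → ℂ) (h : ℝ) (ω : ResonantDir d) (b : Rd d → ℤ → ℤ → ℂ) : ℂ :=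
  ∑' q : {q : Zd d × Zd d // ∃ l : ℤ, q.1 - q.2 = l • ω.p},
    u q.1.1 * conj (u q.1.2) * b (h • projPerp ω q.1.1) (dotZ q.1.2 ω.p) (dotZ q.1.1 ω.p)

/-- A positive finite measure on `ℝ^d` with values in the trace-class operators on
`L²(γ_ω)`, represented (via the Radon–Nikodym theorem for operator-valued
measures) by its scalar trace measure `trMeas` and a measurable field `dens` of
positive Hermitian density matrices of unit trace (in the basis `(φ_m^ω)`). -/
structure OpMeasure (d : ℕ) where
  trMeas : Measure (Rd d)
  finite : IsFiniteMeasure trMeas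
  dens : Rd d → ℤ → ℤ → ℂ
  meas : ∀ m n, Measurable fun ξ => dens ξ m n
  herm : ∀ ξ m n, dens ξ n m = conj (dens ξ m n)
  pos : ∀ ξ, KerPos (dens ξ)
  normalized : ∀ ξ, HasSum (fun m : ℤ => dens ξ m m) 1

/-- The pairing `tr ∫ b(ξ) μ(dξ)` of an operator-valued measure with an
operator-valued test function. -/
def OpMeasure.trPair (M : OpMeasure d) (b : Rd d → ℤ → ℤ → ℂ) : ℂ :=
  ∫ ξ, (∑' q : ℤ × ℤ, b ξ q.2 q.1 * M.dens ξ q.1 q.2) ∂M.trMeas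

/-- Test sections `b ∈ C_c(I_ω; K(L²(γ_ω)))`: continuous, compactly supported,
compact-operator-valued. -/
def IsOpTestField (b : Rd d → ℤ → ℤ → ℂ) : Prop :=
  Continuous b ∧ HasCompactSupport b ∧ ∀ ξ : Rd d, KerCompact (b ξ)

/-- `μR` is a resonant Wigner measure of the sequence `(u_h)`: for every resonant
direction `ω` it is a positive trace-class-operator-valued measure concentrated
on `I_ω` whose matrix entries `(m,n)` vanish unless `m ≡ n (mod |p_ω|²)`, and
`tr ∫ b dR_{u_h}^h(ω,·) → tr ∫ b dμR(ω,·)` for all test sections `b`. -/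
def IsResonantWignerMeasure (D : WignerData d) (μR : ResonantDir d → OpMeasure d) : Prop :=
  ∀ ω : ResonantDir d,
    (μR ω).trMeas {ξ | dotR ω.p ξ ≠ 0} = 0 ∧
    (∀ (ξ : Rd d) (m n : ℤ), ¬ (ω.M ∣ (m - n)) → (μR ω).dens ξ m n = 0) ∧
    ∀ b : Rd d → ℤ → ℤ → ℂ, IsOpTestField b →
      Tendsto (fun n => resPair (D.u n) (D.h n) ω b) atTop (𝓝 ((μR ω).trPair b))

/-- The density matrix of `μ_R^t(ω,·) = e^{it∂_ω²/2} μ_R⁰(ω,·) e^{-it∂_ω²/2}`, the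
solution of the density-matrix Schrödinger equation
`i∂_t μ_R^t = [-(1/2)∂_ω², μ_R^t]` on `γ_ω` with initial datum `μ_R⁰`. -/
def densT (M : OpMeasure d) (ω : ResonantDir d) (t : ℝ) (ξ : Rd d) (m n : ℤ) : ℂ :=
  Complex.exp (-Complex.I * (t : ℂ) * ((((m ^ 2 - n ^ 2 : ℤ) : ℝ) / (2 * (ω.M : ℝ)) : ℝ) : ℂ)) *
    M.dens ξ m n

/-- The geodesic flow `φ_s(x,ξ) = (x + sξ, ξ)` on `T^*𝕋^d`. -/
def geoFlow (s : ℝ) (q : Phase d) : Phase d := (q.1 + torusProj (s • q.2), q.2)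

/-- `g` is (a density of) the signed measure
`ρ_ω^t = E_ω(ρ̃_ω^t(·,ξ) − (2π|p_ω|)⁻¹ (tr μ_R^t(ω,ξ)) ds)` on `𝕋^d × I_ω`, where
`ρ̃_ω^t` is the trace density of `μ_R^t(ω,·)` and `E_ω` the extension operator:
`g` is characterised by its Fourier coefficients in `x`, which are supported on
the frequencies `l p_ω`, `l ≠ 0`, and are given there by the corresponding
traces `∑_{m-n=l|p_ω|²} μ_R^t(ω,·)(m,n)` of the propagated measure. -/
def IsRhoDensity (M : OpMeasure d) (ω : ResonantDir d) (t : ℝ) (g : Phase d → ℝ) : Prop :=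
  Integrable g ((volume : Measure (Td d)).prod M.trMeas) ∧
  (∀ l : ℤ, l ≠ 0 → ∀ φ : Rd d → ℂ, Continuous φ → HasCompactSupport φ →
    ∫ q : Phase d, char (l • ω.p) q.1 * φ q.2 * ((g q : ℝ) : ℂ)
        ∂((volume : Measure (Td d)).prod M.trMeas)
      = ∫ ξ : Rd d, φ ξ * ∑' n : ℤ, densT M ω t ξ (n - l * ω.M) n ∂M.trMeas) ∧
  (∀ k : Zd d, (¬ ∃ l : ℤ, l ≠ 0 ∧ k = l • ω.p) → ∀ φ : Rd d → ℂ, Continuous φ →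
    HasCompactSupport φ →
    ∫ q : Phase d, char k q.1 * φ q.2 * ((g q : ℝ) : ℂ)
        ∂((volume : Measure (Td d)).prod M.trMeas) = 0)

/-- The signed measure `ρ_ω^t` on `T^*𝕋^d` associated to a density `g` (with
respect to `dx ⊗ tr μ_R(ω,·)`). -/
def rhoMeas (M : OpMeasure d) (g : Phase d → ℝ) : SignedMeasure (Phase d) :=
  ((volume : Measure (Td d)).prod M.trMeas).withDensityᵥ g

/-! Symbols, `k_{a,φ}`, `K_b`, position densities, wave packets. -/

/-- The `k`-th Fourier coefficient in `x` of a symbol `a(x,ξ)` on `T^*𝕋^d`: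
`a_k(ξ) = ∫_{𝕋^d} a(x,ξ) conj(ψ_k(x)) dx`. -/
def symbCoeff (a : Phase d → ℂ) (k : Zd d) (ξ : Rd d) : ℂ :=
  ((Real.sqrt ((2 * Real.pi) ^ d) : ℝ) : ℂ)⁻¹ * ∫ x : Td d, a (x, ξ) * conj (char k x)

/-- The Fourier transform `φ̂(s) = ∫ φ(t) e^{-its} dt`. -/
def phiHat (φ : ℝ → ℂ) (s : ℝ) : ℂ :=
  ∫ t : ℝ, φ t * Complex.exp (-Complex.I * (t : ℂ) * (s : ℂ))

/-- The kernel (in the basis `(φ_m^ω)`) of the operator `k_{a,φ}(ω,ξ)` on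
`L²(γ_ω)`. -/
def kerKaphi (a : Phase d → ℂ) (φ : ℝ → ℂ) (ω : ResonantDir d) (ξ : Rd d) (m n : ℤ) : ℂ :=
  if m ≠ n ∧ ω.M ∣ (m - n) then
    ((Real.sqrt ((2 * Real.pi) ^ d) : ℝ) : ℂ)⁻¹ *
      phiHat φ (((n ^ 2 - m ^ 2 : ℤ) : ℝ) / (2 * (ω.M : ℝ))) *
      symbCoeff a (((m - n) / ω.M) • ω.p) ξ
  else 0

/-- The kernel (in the basis `(φ_m^ω)`) of the operator
`K_b = ∫_{I_ω} b(ξ) R_u^h(ω,dξ)` on `L²(γ_ω)`: for `m ≡ n (mod |p_ω|²)`,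
`k_b(m,n) = ∑_{r ∈ ω_c^⊥} b(hr) û((m/|p_ω|)ν_ω+r) conj(û((n/|p_ω|)ν_ω+r))`, using
the parametrisation of `ω_m^⊥` by `{k ∈ ℤ^d : k·p_ω = m}`. -/
def kerKb (u : Zd d → ℂ) (h : ℝ) (ω : ResonantDir d) (b : Rd d → ℂ) (m n : ℤ) : ℂ :=
  if ω.M ∣ (n - m) then
    ∑' k : {k : Zd d // dotZ k ω.p = m},
      b (h • projPerp ω k.1) * u k.1 * conj (u (k.1 + ((n - m) / ω.M) • ω.p))
  else 0

/-- The pairing `∫_{𝕋^d} m(x) |u(x)|² dx` of a position density with a test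
function `m`. -/
def posDenPair (u : Zd d → ℂ) (m : Td d → ℂ) : ℂ :=
  (((2 * Real.pi) ^ d : ℝ) : ℂ)⁻¹ *
    ∑' q : Zd d × Zd d, u q.1 * conj (u q.2) * ∫ x : Td d, m x * char (q.1 - q.2) x

/-- Fourier coefficients of the `2πℤ^d`-periodisation of the wave packet
`h^{-d/4} ρ((x-x₀)/√h) e^{iξ₀·x/h}` (for `ρ` supported in `(-π,π)^d`). -/
def wavePacket (ρ : Rd d → ℂ) (x₀ ξ₀ : Rd d) (h : ℝ) (k : Zd d) : ℂ :=
  ((Real.sqrt ((2 * Real.pi) ^ d) : ℝ) : ℂ)⁻¹ *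
    ∫ x : Rd d, ((h ^ (-(d : ℝ) / 4) : ℝ) : ℂ) * ρ (fun i => (x i - x₀ i) / Real.sqrt h) *
      Complex.exp (Complex.I * ((∑ i, (ξ₀ i / h - (k i : ℝ)) * x i : ℝ) : ℂ))

/-- Fourier coefficients of the `2πℤ^d`-periodisation of `ρ(x) e^{iξ₀·x/h}` (for
`ρ` supported in `(-π,π)^d`). -/
def oscData (ρ : Rd d → ℂ) (ξ₀ : Rd d) (h : ℝ) (k : Zd d) : ℂ :=
  ((Real.sqrt ((2 * Real.pi) ^ d) : ℝ) : ℂ)⁻¹ *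
    ∫ x : Rd d, ρ x * Complex.exp (Complex.I * ((∑ i, (ξ₀ i / h - (k i : ℝ)) * x i : ℝ) : ℂ))

/-- The solution `e^{itΔ/2} ρ_per` on `𝕋^d`, where `ρ_per` is the
`2πℤ^d`-periodisation of `ρ`. -/
def evolvedPer (ρ : Rd d → ℂ) (t : ℝ) (x : Td d) : ℂ :=
  ((Real.sqrt ((2 * Real.pi) ^ d) : ℝ) : ℂ)⁻¹ *
    ∑' k : Zd d,
      Complex.exp (-Complex.I * (t : ℂ) * ((∑ i, ((k i : ℝ)) ^ 2 : ℝ) : ℂ) / 2) *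
        oscData ρ 0 1 k * char k x

/-- Euclidean norm on `ℝ^d`. -/
def euclNorm (ξ : Rd d) : ℝ := Real.sqrt (∑ i, ξ i ^ 2)

/-- The length `L` of the periodic geodesic of `𝕋^d` issued from `(x, ξ₀)`: the
least `l > 0` such that `l·ξ₀/|ξ₀| ∈ 2πℤ^d`. -/
def geoLen (ξ₀ : Rd d) : ℝ :=
  sInf {l : ℝ | 0 < l ∧ ∃ k : Zd d, (l / euclNorm ξ₀) • ξ₀ = (2 * Real.pi) • toRd k}

/-- The average `⟨f⟩_{ξ₀}(x) = (|ξ₀|/L)∫_0^{L/|ξ₀|} f(x+sξ₀) ds` along the closed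
geodesic in the direction `ξ₀`. -/
def geoAvg (f : Td d → ℝ) (ξ₀ : Rd d) (x : Td d) : ℝ :=
  euclNorm ξ₀ / geoLen ξ₀ *
    ∫ s in Set.Ioc (0 : ℝ) (geoLen ξ₀ / euclNorm ξ₀), f (x + torusProj (s • ξ₀))

lemma ResonantDir.M_pos (ω : ResonantDir d) : 0 < ω.M := by
  obtain ⟨i, hi⟩ := Function.ne_iff.mp ω.ne
  exact Finset.sum_pos' (fun j _ => mul_self_nonneg _) ⟨i, Finset.mem_univ _, mul_self_pos.mpr hi⟩

lemma dotZ_add_zsmul (ω : ResonantDir d) (k : Zd d) (l : ℤ) :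
    dotZ (k + l • ω.p) ω.p = dotZ k ω.p + l * ω.M := by
  simp only [dotZ, ResonantDir.M, Finset.mul_sum, ← Finset.sum_add_distrib]
  refine Finset.sum_congr rfl fun i _ => ?_
  simp only [Pi.add_apply, Pi.smul_apply, smul_eq_mul]
  ring

lemma projPerp_add_zsmul (ω : ResonantDir d) (k : Zd d) (l : ℤ) :
    projPerp ω (k + l • ω.p) = projPerp ω k := by
  have hM : (ω.M : ℝ) ≠ 0 := by exact_mod_cast ω.M_pos.ne'
  ext i
  simp only [projPerp, dotZ_add_zsmul, toRd, Pi.sub_apply, Pi.smul_apply, Pi.add_apply,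
    smul_eq_mul]
  push_cast
  field_simp
  ring

lemma dotR_smul_projPerp (ω : ResonantDir d) (h : ℝ) (k : Zd d) :
    dotR ω.p (h • projPerp ω k) = 0 := by
  have hM : (ω.M : ℝ) ≠ 0 := by exact_mod_cast ω.M_pos.ne'
  have hMsum : (ω.M : ℝ) = ∑ i, (ω.p i : ℝ) * ω.p i := by simp [ResonantDir.M, dotZ]
  have hdot : (dotZ k ω.p : ℝ) = ∑ i, (k i : ℝ) * ω.p i := by simp [dotZ]
  calc dotR ω.p (h • projPerp ω k)
      = h * ((dotZ k ω.p : ℝ) - (dotZ k ω.p : ℝ) / ω.M * (ω.M : ℝ)) := by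
        conv_rhs =>
          enter [2]
          congr
          · rw [hdot]
          · enter [2]; rw [hMsum]
        rw [Finset.mul_sum, ← Finset.sum_sub_distrib, Finset.mul_sum]
        refine Finset.sum_congr rfl fun i _ => ?_
        simp only [projPerp, toRd, Pi.sub_apply, Pi.smul_apply, smul_eq_mul]
        ring
    _ = 0 := by rw [div_mul_cancel₀ _ hM, sub_self, mul_zero]

/-- Coordinates on `ℤ^d` adapted to the cosets of `ℤ p_ω`. -/
def cosetCoord (ω : ResonantDir d) (x : (Zd d ⧸ AddSubgroup.zmultiples ω.p) × ℤ) : Zd d :=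
  x.1.out + x.2 • ω.p

lemma cosetCoord_bijective (ω : ResonantDir d) : Function.Bijective (cosetCoord ω) := by
  constructor
  · rintro ⟨c, l⟩ ⟨c', l'⟩ hx
    simp only [cosetCoord] at hx
    have hc : c = c' := by
      rw [← QuotientAddGroup.out_eq' c, ← QuotientAddGroup.out_eq' c']
      rw [QuotientAddGroup.eq, AddSubgroup.mem_zmultiples_iff]
      exact ⟨l - l', by rw [sub_smul]; linear_combination hx⟩
    subst hc
    have := smul_left_injective ℤ ω.ne (add_left_cancel hx)
    simp [this]
  · intro k
    have : -((k : Zd d ⧸ AddSubgroup.zmultiples ω.p).out) + k ∈ AddSubgroup.zmultiples ω.p := by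
      rw [← QuotientAddGroup.eq, QuotientAddGroup.out_eq']
    obtain ⟨l, hl⟩ := AddSubgroup.mem_zmultiples_iff.mp this
    exact ⟨(k, l), by simp only [cosetCoord, hl]; abel⟩

lemma summable_mul_and_sq_tsum_mul_le {ι : Type*} {f g : ι → ℝ} (hf : ∀ i, 0 ≤ f i)
    (hg : ∀ i, 0 ≤ g i) (hf2 : Summable fun i => f i ^ 2) (hg2 : Summable fun i => g i ^ 2) :
    (Summable fun i => f i * g i) ∧
      (∑' i, f i * g i) ^ 2 ≤ (∑' i, f i ^ 2) * ∑' i, g i ^ 2 := by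
  obtain ⟨h1, h2⟩ := Real.summable_and_inner_le_Lp_mul_Lq_tsum_of_nonneg
    Real.HolderConjugate.two_two hf hg (by simpa using hf2) (by simpa using hg2)
  refine ⟨h1, ?_⟩
  have h0 : 0 ≤ ∑' i, f i * g i := tsum_nonneg fun i => mul_nonneg (hf i) (hg i)
  simp only [Real.rpow_two, ← Real.sqrt_eq_rpow] at h2
  calc _ ≤ (√(∑' i, f i ^ 2) * √(∑' i, g i ^ 2)) ^ 2 := by gcongr
    _ = _ := by
      rw [mul_pow, Real.sq_sqrt (tsum_nonneg fun i => sq_nonneg _),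
        Real.sq_sqrt (tsum_nonneg fun i => sq_nonneg _)]

/-- The factor `v_n conj(û)` on the lattice line through `c.out` in the direction `ω`. -/
def lineTerm (u : Zd d → ℂ) (ω : ResonantDir d) (v : ℤ → ℂ)
    (c : Zd d ⧸ AddSubgroup.zmultiples ω.p) (l : ℤ) : ℂ :=
  v (dotZ c.out ω.p + l * ω.M) * conj (u (c.out + l • ω.p))

lemma summable_norm_lineTerm_and_sq_tsum_le {u : Zd d → ℂ} (hu : Summable fun k => ‖u k‖ ^ 2)
    (ω : ResonantDir d) {v : ℤ → ℂ} (hv : Summable fun m => ‖v m‖ ^ 2)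
    (c : Zd d ⧸ AddSubgroup.zmultiples ω.p) :
    (Summable fun l => ‖lineTerm u ω v c l‖) ∧
      (∑' l, ‖lineTerm u ω v c l‖) ^ 2 ≤
        (∑' m, ‖v m‖ ^ 2) * ∑' l, ‖u (cosetCoord ω (c, l))‖ ^ 2 := by
  have hinj : Function.Injective fun l : ℤ => dotZ c.out ω.p + l * ω.M := fun l l' hl =>
    mul_right_cancel₀ ω.M_pos.ne' (add_left_cancel hl)
  have huc : Summable fun l => ‖u (cosetCoord ω (c, l))‖ ^ 2 :=
    hu.comp_injective ((cosetCoord_bijective ω).1.comp (Prod.mk_right_injective c))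
  obtain ⟨h1, h2⟩ := summable_mul_and_sq_tsum_mul_le (fun _ => norm_nonneg _)
    (fun _ => norm_nonneg _) (hv.comp_injective hinj) huc
  have heq : (fun l => ‖lineTerm u ω v c l‖) = fun l =>
      ‖v (dotZ c.out ω.p + l * ω.M)‖ * ‖u (cosetCoord ω (c, l))‖ := by
    ext l
    rw [lineTerm, norm_mul, RCLike.norm_conj, cosetCoord]
  rw [heq]
  refine ⟨h1, h2.trans (mul_le_mul_of_nonneg_right ?_ (tsum_nonneg fun _ => sq_nonneg _))⟩
  exact tsum_comp_le_tsum_of_inj hv (fun _ => sq_nonneg _) hinj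

/-- The terms of the quadratic form of `K_b`, indexed by a coset of `ℤ p_ω` and two points
of it. -/
def formTerm (u : Zd d → ℂ) (h : ℝ) (ω : ResonantDir d) (b : Rd d → ℝ) (v : ℤ → ℂ)
    (x : (Zd d ⧸ AddSubgroup.zmultiples ω.p) × (ℤ × ℤ)) : ℂ :=
  (b (h • projPerp ω x.1.out) : ℂ) *
    (lineTerm u ω v x.1 x.2.2 * conj (lineTerm u ω v x.1 x.2.1))

lemma summable_formTerm {u : Zd d → ℂ} (hu : Summable fun k => ‖u k‖ ^ 2)
    (h : ℝ) (ω : ResonantDir d) {b : Rd d → ℝ} {B : ℝ} (hB : ∀ ξ, ‖b ξ‖ ≤ B)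
    {v : ℤ → ℂ} (hv : Summable fun m => ‖v m‖ ^ 2) : Summable (formTerm u h ω b v) := by
  have hline := summable_norm_lineTerm_and_sq_tsum_le hu ω hv
  have hB0 : 0 ≤ B := (norm_nonneg _).trans (hB 0)
  suffices hs : Summable fun x : (Zd d ⧸ AddSubgroup.zmultiples ω.p) × (ℤ × ℤ) =>
      B * (‖lineTerm u ω v x.1 x.2.1‖ * ‖lineTerm u ω v x.1 x.2.2‖) by
    refine hs.of_norm_bounded fun x => ?_
    rw [formTerm, norm_mul, norm_mul, RCLike.norm_conj, Complex.norm_real,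
      mul_comm ‖lineTerm u ω v x.1 x.2.2‖]
    gcongr
    exact hB _
  refine Summable.mul_left B ?_
  have hprod (c) : Summable fun y : ℤ × ℤ =>
      ‖lineTerm u ω v c y.1‖ * ‖lineTerm u ω v c y.2‖ :=
    (hline c).1.mul_of_nonneg (hline c).1 (fun _ => norm_nonneg _) (fun _ => norm_nonneg _)
  rw [summable_prod_of_nonneg fun _ => by positivity]
  refine ⟨hprod, ?_⟩
  have hsum : Summable fun c => (∑' m, ‖v m‖ ^ 2) * ∑' l, ‖u (cosetCoord ω (c, l))‖ ^ 2 :=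
    Summable.mul_left _ <|
      (hu.comp_injective (cosetCoord_bijective ω).1 : Summable fun x =>
        ‖u (cosetCoord ω x)‖ ^ 2).prod
  refine hsum.of_nonneg_of_le (fun c => tsum_nonneg fun _ => by positivity) fun c => ?_
  rw [← (hline c).1.tsum_mul_tsum (hline c).1 (hprod c), ← sq]
  exact (hline c).2

lemma tsum_formTerm_coset {u : Zd d → ℂ} (hu : Summable fun k => ‖u k‖ ^ 2)
    (h : ℝ) (ω : ResonantDir d) (b : Rd d → ℝ) {v : ℤ → ℂ} (hv : Summable fun m => ‖v m‖ ^ 2)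
    (c : Zd d ⧸ AddSubgroup.zmultiples ω.p) :
    ∑' y, formTerm u h ω b v (c, y) =
      (b (h • projPerp ω c.out) : ℂ) * ((‖∑' l, lineTerm u ω v c l‖ ^ 2 : ℝ) : ℂ) := by
  have hs := (summable_norm_lineTerm_and_sq_tsum_le hu ω hv c).1
  simp only [formTerm, tsum_mul_left]
  congr 1
  rw [Complex.ofReal_pow, ← Complex.conj_mul', Complex.conj_tsum,
    tsum_mul_tsum_of_summable_norm (by simpa using hs) hs]
  exact tsum_congr fun y => mul_comm _ _

/-- The pair `(m, n)` of indices of the matrix coefficient containing a term of the form. -/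
def formIndex (ω : ResonantDir d) (x : (Zd d ⧸ AddSubgroup.zmultiples ω.p) × (ℤ × ℤ)) : ℤ × ℤ :=
  (dotZ x.1.out ω.p + x.2.1 * ω.M, dotZ x.1.out ω.p + x.2.2 * ω.M)

lemma tsum_formTerm_fiber (u : Zd d → ℂ) (h : ℝ) (ω : ResonantDir d) (b : Rd d → ℝ)
    (v : ℤ → ℂ) (q : ℤ × ℤ) :
    ∑' x : formIndex ω ⁻¹' {q}, formTerm u h ω b v x =
      kerKb u h ω (fun ξ => (b ξ : ℂ)) q.1 q.2 * v q.2 * conj (v q.1) := by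
  obtain ⟨m, n⟩ := q
  have hM := ω.M_pos.ne'
  have hmem (x) : x ∈ formIndex ω ⁻¹' {(m, n)} ↔
      dotZ x.1.out ω.p + x.2.1 * ω.M = m ∧ dotZ x.1.out ω.p + x.2.2 * ω.M = n := by
    simp [formIndex]
  have hdiff {c : Zd d ⧸ AddSubgroup.zmultiples ω.p} {l l' : ℤ}
      (h1 : dotZ c.out ω.p + l * ω.M = m) (h2 : dotZ c.out ω.p + l' * ω.M = n) :
      n - m = (l' - l) * ω.M := by linear_combination h1 - h2
  simp only [kerKb]
  split_ifs with hdvd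
  · let ψ : formIndex ω ⁻¹' {(m, n)} → {k : Zd d // dotZ k ω.p = m} := fun x =>
      ⟨cosetCoord ω (x.1.1, x.1.2.1), by
        rw [cosetCoord, dotZ_add_zsmul]; exact ((hmem _).1 x.2).1⟩
    have hψ : Function.Bijective ψ := by
      constructor
      · rintro ⟨⟨c, l, l'⟩, hx⟩ ⟨⟨c₁, l₁, l₁'⟩, hx₁⟩ heq
        have h1 := (cosetCoord_bijective ω).1 (congrArg Subtype.val heq)
        simp only [Prod.mk.injEq] at h1
        obtain ⟨rfl, rfl⟩ := h1
        have h2 : l' = l₁' := mul_right_cancel₀ hM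
          (add_left_cancel (((hmem _).1 hx).2.trans ((hmem _).1 hx₁).2.symm))
        subst h2
        rfl
      · rintro ⟨k, hk⟩
        obtain ⟨⟨c, l⟩, rfl⟩ := (cosetCoord_bijective ω).2 k
        have hk' := hk
        rw [cosetCoord, dotZ_add_zsmul] at hk'
        obtain ⟨j, hj⟩ := hdvd
        exact ⟨⟨(c, l, l + j), (hmem _).2 ⟨hk', by linear_combination hk' - hj⟩⟩, rfl⟩
    rw [← (Equiv.ofBijective ψ hψ).tsum_eq, ← tsum_mul_right, ← tsum_mul_right]
    refine tsum_congr ?_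
    rintro ⟨⟨c, l, l'⟩, hx⟩
    obtain ⟨h1, h2⟩ := (hmem _).1 hx
    have hpt : c.out + l • ω.p + ((n - m) / ω.M) • ω.p = c.out + l' • ω.p := by
      rw [hdiff h1 h2, Int.mul_ediv_cancel _ hM, add_assoc, ← add_smul, add_sub_cancel]
    simp only [Equiv.ofBijective_apply, ψ, cosetCoord, formTerm, lineTerm, projPerp_add_zsmul, hpt]
    simp only at h1 h2
    rw [h1, h2, map_mul, Complex.conj_conj]
    ring
  · have : IsEmpty (formIndex ω ⁻¹' {(m, n)}) := ⟨fun x => by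
      obtain ⟨h1, h2⟩ := (hmem _).1 x.2
      exact hdvd (hdiff h1 h2 ▸ dvd_mul_left _ _)⟩
    simp

/-- the quadratic form of `K_b`:
`(K_b v | v) = ∑_{[c]} ∑_{r ∈ ω_c^⊥} b(hr) |∑_{n ∈ [c]} v_n û((n/|p_ω|)ν_ω+r)|²`
for every `v = ∑ v_m φ_m^ω ∈ L²(γ_ω)`; in particular `(K_b v|v) ≥ 0` when
`b ≥ 0` on `I_ω`.  The pairs `([c], r)` are parametrised by the cosets of
`ℤ p_ω` in `ℤ^d`: for a coset `c` with representative `c.out`,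
`r = projPerp ω c.out` and the elements `n ∈ [c]` correspond to
`n = c.out·p_ω + l|p_ω|²`, their lattice points being `c.out + l p_ω`, `l ∈ ℤ`. -/
theorem statement9 {d : ℕ} (u : Zd d → ℂ) (hu : Summable fun k => ‖u k‖ ^ 2)
    (h : ℝ) (hh : 0 < h) (ω : ResonantDir d)
    (b : Rd d → ℝ) (hb : Continuous b) (hbc : HasCompactSupport b)
    (v : ℤ → ℂ) (hv : Summable fun m => ‖v m‖ ^ 2) :
    (∑' q : ℤ × ℤ, kerKb u h ω (fun ξ => (b ξ : ℂ)) q.1 q.2 * v q.2 * conj (v q.1))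
      = (∑' c : Zd d ⧸ AddSubgroup.zmultiples ω.p,
          ((b (h • projPerp ω c.out) : ℝ) : ℂ) *
            ((‖∑' l : ℤ, v (dotZ c.out ω.p + l * ω.M) * conj (u (c.out + l • ω.p))‖ ^ 2 : ℝ) :
              ℂ)) ∧
    ((∀ ξ : Rd d, dotR ω.p ξ = 0 → 0 ≤ b ξ) →
      0 ≤ (∑' q : ℤ × ℤ,
            kerKb u h ω (fun ξ => (b ξ : ℂ)) q.1 q.2 * v q.2 * conj (v q.1)).re) := by
  obtain ⟨B, hB⟩ := hbc.exists_bound_of_continuous hb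
  have hs := summable_formTerm hu h ω hB hv
  have key : (∑' q : ℤ × ℤ, kerKb u h ω (fun ξ => (b ξ : ℂ)) q.1 q.2 * v q.2 * conj (v q.1))
      = (∑' c : Zd d ⧸ AddSubgroup.zmultiples ω.p,
          ((b (h • projPerp ω c.out) : ℝ) : ℂ) *
            ((‖∑' l : ℤ, v (dotZ c.out ω.p + l * ω.M) * conj (u (c.out + l • ω.p))‖ ^ 2 : ℝ) :
              ℂ)) := by
    simp only [← tsum_formTerm_fiber]
    rw [(hs.hasSum.tsum_fiberwise (formIndex ω)).tsum_eq, hs.tsum_prod]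
    exact tsum_congr fun c => tsum_formTerm_coset hu h ω b hv c
  refine ⟨key, fun hpos => ?_⟩
  simp only [key, ← Complex.ofReal_mul, ← Complex.ofReal_tsum, Complex.ofReal_re]
  exact tsum_nonneg fun c => mul_nonneg (hpos _ (dotR_smul_projPerp ω h _)) (sq_nonneg _)

end TorusSchrodinger
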